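/- Let C_1 ⊆ F_q^{n_1} and C_2 ⊆ F_q^{n_2} be linear codes of dimensions k_1 and k_2. Define C = (F_q^{n_1} ⊗ C_2^⊥) × (C_1^⊥ ⊗ F_q^{n_2}) ⊆ F_q^{2 n_1 n_2}. Then the symplectic dual of C is C^{⊥_s} = (C_1 ⊗ F_q^{n_2}) × (F_q^{n_1} ⊗ C_2), and dim C = n_1(n_2−k_2) + n_2(n_1−k_1), dim C^{⊥_s} = k_1 n_2 + n_1 k_2. -/

import Mathlib

set_option linter.unusedSectionVars false

open Finset

variable {F : Type*} [Field F] [Fintype F]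

/-- Euclidean dot product. -/
def dotp {ι : Type*} [Fintype ι] (a b : ι → F) : F := ∑ i, a i * b i

/-- Symplectic product of u=(a|b), v=(a'|b'): a'·b − a·b'. -/
def sform {ι : Type*} [Fintype ι] (u v : (ι → F) × (ι → F)) : F :=
  dotp v.1 u.2 - dotp u.1 v.2

lemma dotp_add_right {ι : Type*} [Fintype ι] (a b c : ι → F) :
    dotp a (b + c) = dotp a b + dotp a c := by
  simp [dotp, mul_add, Finset.sum_add_distrib]

lemma dotp_add_left {ι : Type*} [Fintype ι] (a b c : ι → F) :
    dotp (a + b) c = dotp a c + dotp b c := by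
  simp [dotp, add_mul, Finset.sum_add_distrib]

lemma dotp_smul_right {ι : Type*} [Fintype ι] (r : F) (a b : ι → F) :
    dotp a (r • b) = r * dotp a b := by
  simp only [dotp, Pi.smul_apply, smul_eq_mul, Finset.mul_sum]
  exact Finset.sum_congr rfl fun i _ => by ring

lemma dotp_smul_left {ι : Type*} [Fintype ι] (r : F) (a b : ι → F) :
    dotp (r • a) b = r * dotp a b := by
  simp only [dotp, Pi.smul_apply, smul_eq_mul, Finset.mul_sum]
  exact Finset.sum_congr rfl fun i _ => by ring

/-- Euclidean dual of a code. -/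
def eperp {ι : Type*} [Fintype ι] (X : Submodule F (ι → F)) : Submodule F (ι → F) where
  carrier := {y | ∀ x ∈ X, dotp x y = 0}
  add_mem' := by
    intro a b ha hb x hx
    rw [dotp_add_right, ha x hx, hb x hx, add_zero]
  zero_mem' := by intro x hx; simp [dotp]
  smul_mem' := by
    intro r a ha x hx
    rw [dotp_smul_right, ha x hx, mul_zero]

/-- Symplectic dual of a code. -/
def sperp {ι : Type*} [Fintype ι] (C : Submodule F ((ι → F) × (ι → F))) :
    Submodule F ((ι → F) × (ι → F)) where
  carrier := {x | ∀ y ∈ C, sform y x = 0}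
  add_mem' := by
    intro a b ha hb y hy
    have h1 := ha y hy; have h2 := hb y hy
    simp only [sform, Prod.fst_add, Prod.snd_add, dotp_add_left, dotp_add_right] at *
    linear_combination h1 + h2
  zero_mem' := by intro y hy; simp [sform, dotp]
  smul_mem' := by
    intro r a ha y hy
    have h := ha y hy
    simp only [sform, Prod.smul_fst, Prod.smul_snd, dotp_smul_left, dotp_smul_right] at *
    linear_combination r * h

/-- Symplectic weight. -/
def swt {ι : Type*} [Fintype ι] [DecidableEq F] (u : (ι → F) × (ι → F)) : ℕ :=
  (Finset.univ.filter fun i => ¬(u.1 i = 0 ∧ u.2 i = 0)).card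

/-- Tensor product of codes. -/
def tcode {ι κ : Type*} [Fintype ι] [Fintype κ] (A : Submodule F (ι → F))
    (B : Submodule F (κ → F)) : Submodule F (ι × κ → F) :=
  Submodule.span F {w | ∃ a ∈ A, ∃ b ∈ B, w = fun p => a p.1 * b p.2}

lemma dotp_comm {ι : Type*} [Fintype ι] (a b : ι → F) : dotp a b = dotp b a := by
  simp only [dotp, mul_comm]

lemma dotp_eq_toBilin'_one {ι : Type*} [Fintype ι] [DecidableEq ι] (a b : ι → F) :
    Matrix.toBilin' (1 : Matrix ι ι F) a b = dotp a b := by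
  simp [Matrix.toBilin'_apply', dotProduct, dotp]

lemma eperp_eq_orthogonal {ι : Type*} [Fintype ι] [DecidableEq ι] (X : Submodule F (ι → F)) :
    eperp X = (Matrix.toBilin' (1 : Matrix ι ι F)).orthogonal X := by
  ext y
  simp only [LinearMap.BilinForm.mem_orthogonal_iff, dotp_eq_toBilin'_one]
  rfl

lemma nondegenerate_toBilin'_one {ι : Type*} [Fintype ι] [DecidableEq ι] :
    (Matrix.toBilin' (1 : Matrix ι ι F)).Nondegenerate :=
  LinearMap.BilinForm.nondegenerate_toBilin'_of_det_ne_zero' _ (by simp)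

lemma finrank_eperp {ι : Type*} [Fintype ι] (X : Submodule F (ι → F)) :
    Module.finrank F (eperp X) = Fintype.card ι - Module.finrank F X := by
  classical
  rw [eperp_eq_orthogonal, LinearMap.BilinForm.finrank_orthogonal nondegenerate_toBilin'_one,
    Module.finrank_fintype_fun_eq_card]

lemma eperp_eperp {ι : Type*} [Fintype ι] (X : Submodule F (ι → F)) : eperp (eperp X) = X := by
  classical
  rw [eperp_eq_orthogonal, eperp_eq_orthogonal]
  refine LinearMap.BilinForm.orthogonal_orthogonal nondegenerate_toBilin'_one ?_ X
  intro x y h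
  rwa [dotp_eq_toBilin'_one, dotp_comm, ← dotp_eq_toBilin'_one]

lemma comp_swap_mem_tcode {ι κ : Type*} [Fintype ι] [Fintype κ] {A : Submodule F (ι → F)}
    {B : Submodule F (κ → F)} {w : ι × κ → F} (hw : w ∈ tcode A B) :
    w ∘ Prod.swap ∈ tcode B A := by
  have h : tcode A B ≤ (tcode B A).comap (LinearMap.funLeft F F Prod.swap) := by
    refine Submodule.span_le.2 ?_
    rintro _ ⟨a, ha, b, hb, rfl⟩
    exact Submodule.subset_span ⟨b, hb, a, ha, funext fun p => mul_comm _ _⟩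
  exact h hw

lemma mem_tcode_comm {ι κ : Type*} [Fintype ι] [Fintype κ] {A : Submodule F (ι → F)}
    {B : Submodule F (κ → F)} {w : ι × κ → F} :
    w ∈ tcode A B ↔ w ∘ Prod.swap ∈ tcode B A :=
  ⟨comp_swap_mem_tcode, fun h => comp_swap_mem_tcode h⟩

/-- A word lies in `A ⊗ F^κ` exactly when all its columns lie in `A`. -/
lemma mem_tcode_top_right {ι κ : Type*} [Fintype ι] [Fintype κ] {A : Submodule F (ι → F)}
    {w : ι × κ → F} :
    w ∈ tcode A (⊤ : Submodule F (κ → F)) ↔ ∀ j, (fun i => w (i, j)) ∈ A := by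
  classical
  constructor
  · intro hw j
    have h : tcode A (⊤ : Submodule F (κ → F)) ≤
        A.comap (LinearMap.funLeft F F fun i : ι => (i, j)) := by
      refine Submodule.span_le.2 ?_
      rintro _ ⟨a, ha, b, -, rfl⟩
      have hab : (fun i => a i * b j) = b j • a := funext fun i => mul_comm _ _
      change (fun i => a i * b j) ∈ A
      exact hab ▸ A.smul_mem _ ha
    exact h hw
  · intro h
    have hw : w = ∑ j, fun p : ι × κ => w (p.1, j) * (Pi.single j 1 : κ → F) p.2 := by
      ext ⟨i, k⟩
      simp [Finset.sum_apply, Pi.single_apply]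
    rw [hw]
    exact Submodule.sum_mem _ fun j _ => Submodule.subset_span
      ⟨_, h j, Pi.single j 1, Submodule.mem_top, rfl⟩

/-- The code `A ⊗ F^κ` is a direct sum of copies of `A` indexed by the columns. -/
def tcodeTopRightEquiv {ι : Type*} (κ : Type*) [Fintype ι] [Fintype κ]
    (A : Submodule F (ι → F)) : tcode A (⊤ : Submodule F (κ → F)) ≃ₗ[F] (κ → A) where
  toFun w j := ⟨fun i => w.1 (i, j), mem_tcode_top_right.1 w.2 j⟩
  invFun v := ⟨fun p => (v p.2).1 p.1, mem_tcode_top_right.2 fun j => (v j).2⟩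
  map_add' _ _ := rfl
  map_smul' _ _ := rfl
  left_inv _ := rfl
  right_inv _ := rfl

/-- Exchanging rows and columns identifies `A ⊗ B` with `B ⊗ A`. -/
def tcodeComm {ι κ : Type*} [Fintype ι] [Fintype κ] (A : Submodule F (ι → F))
    (B : Submodule F (κ → F)) : tcode A B ≃ₗ[F] tcode B A where
  toFun w := ⟨w.1 ∘ Prod.swap, comp_swap_mem_tcode w.2⟩
  invFun w := ⟨w.1 ∘ Prod.swap, comp_swap_mem_tcode w.2⟩
  map_add' _ _ := rfl
  map_smul' _ _ := rfl
  left_inv _ := rfl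
  right_inv _ := rfl

lemma finrank_tcode_top_right {ι κ : Type*} [Fintype ι] [Fintype κ] (A : Submodule F (ι → F)) :
    Module.finrank F (tcode A (⊤ : Submodule F (κ → F)))
      = Fintype.card κ * Module.finrank F A := by
  rw [(tcodeTopRightEquiv κ A).finrank_eq, Module.finrank_pi_fintype]
  simp

lemma finrank_tcode_top_left {ι κ : Type*} [Fintype ι] [Fintype κ] (B : Submodule F (κ → F)) :
    Module.finrank F (tcode (⊤ : Submodule F (ι → F)) B)
      = Fintype.card ι * Module.finrank F B := by
  rw [(tcodeComm _ _).finrank_eq, finrank_tcode_top_right]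

lemma dotp_comp_swap {ι κ : Type*} [Fintype ι] [Fintype κ] (v w : ι × κ → F) :
    dotp (v ∘ Prod.swap) (w ∘ Prod.swap) = dotp v w :=
  Equiv.sum_comp (Equiv.prodComm κ ι) fun p => v p * w p

lemma eperp_tcode_top_right {ι κ : Type*} [Fintype ι] [Fintype κ] (A : Submodule F (ι → F)) :
    eperp (tcode A (⊤ : Submodule F (κ → F))) = tcode (eperp A) ⊤ := by
  classical
  ext w
  rw [mem_tcode_top_right]
  constructor
  · intro hw j a ha
    have h := hw _ (Submodule.subset_span ⟨a, ha, Pi.single j 1, Submodule.mem_top, rfl⟩)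
    simpa [dotp, Fintype.sum_prod_type, Pi.single_apply] using h
  · intro hw v hv
    rw [dotp, Fintype.sum_prod_type_right]
    exact Finset.sum_eq_zero fun j _ => hw j _ (mem_tcode_top_right.1 hv j)

lemma eperp_tcode_top_left {ι κ : Type*} [Fintype ι] [Fintype κ] (B : Submodule F (κ → F)) :
    eperp (tcode (⊤ : Submodule F (ι → F)) B) = tcode ⊤ (eperp B) := by
  ext w
  rw [mem_tcode_comm, ← eperp_tcode_top_right]
  constructor
  · intro hw v hv
    rw [← dotp_comp_swap]
    exact hw _ (comp_swap_mem_tcode hv)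
  · intro hw v hv
    rw [← dotp_comp_swap]
    exact hw _ (comp_swap_mem_tcode hv)

lemma sperp_prod {ι : Type*} [Fintype ι] (X Y : Submodule F (ι → F)) :
    sperp (X.prod Y) = (eperp Y).prod (eperp X) := by
  ext ⟨a, b⟩
  constructor
  · intro h
    refine ⟨fun y hy => ?_, fun x hx => ?_⟩
    · have := h (0, y) ⟨X.zero_mem, hy⟩
      rw [dotp_comm]
      simpa [sform, dotp] using this
    · have := h (x, 0) ⟨hx, Y.zero_mem⟩
      simpa [sform, dotp] using this
  · rintro ⟨ha, hb⟩ ⟨x, y⟩ ⟨hx, hy⟩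
    have h₁ : dotp y a = 0 := ha y hy
    have h₂ : dotp x b = 0 := hb x hx
    simp [sform, dotp_comm a y, h₁, h₂]

lemma finrank_submodule_prod {V W : Type*} [AddCommGroup V] [Module F V] [AddCommGroup W]
    [Module F W] [Module.Finite F V] [Module.Finite F W] (p : Submodule F V)
    (q : Submodule F W) :
    Module.finrank F (p.prod q) = Module.finrank F p + Module.finrank F q := by
  let e : p.prod q ≃ₗ[F] p × q :=
    { toFun := fun x => (⟨x.1.1, x.2.1⟩, ⟨x.1.2, x.2.2⟩)
      invFun := fun x => ⟨(x.1.1, x.2.1), x.1.2, x.2.2⟩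
      map_add' := fun _ _ => rfl
      map_smul' := fun _ _ => rfl
      left_inv := fun _ => rfl
      right_inv := fun _ => rfl }
  rw [e.finrank_eq, Module.finrank_prod]

/-- for `C = (F_q^{n_1} ⊗ C_2^⊥) × (C_1^⊥ ⊗ F_q^{n_2})` one has
`C^{⊥_s} = (C_1 ⊗ F_q^{n_2}) × (F_q^{n_1} ⊗ C_2)`,
`dim C = n_1(n_2−k_2) + n_2(n_1−k_1)` and `dim C^{⊥_s} = k_1 n_2 + n_1 k_2`. -/
theorem lattice_code_sperp {n1 n2 : ℕ}
    (C1 : Submodule F (Fin n1 → F)) (C2 : Submodule F (Fin n2 → F)) (k1 k2 : ℕ)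
    (h1 : Module.finrank F C1 = k1) (h2 : Module.finrank F C2 = k2) :
    sperp ((tcode (⊤ : Submodule F (Fin n1 → F)) (eperp C2)).prod
        (tcode (eperp C1) (⊤ : Submodule F (Fin n2 → F))))
      = (tcode C1 (⊤ : Submodule F (Fin n2 → F))).prod
          (tcode (⊤ : Submodule F (Fin n1 → F)) C2) ∧
    Module.finrank F ↥((tcode (⊤ : Submodule F (Fin n1 → F)) (eperp C2)).prod
        (tcode (eperp C1) (⊤ : Submodule F (Fin n2 → F))))
      = n1 * (n2 - k2) + n2 * (n1 - k1) ∧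
    Module.finrank F ↥((tcode C1 (⊤ : Submodule F (Fin n2 → F))).prod
        (tcode (⊤ : Submodule F (Fin n1 → F)) C2))
      = k1 * n2 + n1 * k2 := by
  refine ⟨?_, ?_, ?_⟩
  · rw [sperp_prod, eperp_tcode_top_left, eperp_tcode_top_right, eperp_eperp, eperp_eperp]
  · rw [finrank_submodule_prod, finrank_tcode_top_left, finrank_tcode_top_right, finrank_eperp,
      finrank_eperp, h1, h2, Fintype.card_fin, Fintype.card_fin]
  · rw [finrank_submodule_prod, finrank_tcode_top_left, finrank_tcode_top_right, h1, h2,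
      Fintype.card_fin, Fintype.card_fin, mul_comm n2]
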